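/- Proposition (Proposition 2.6(1)). Let K ⊆ {1, …, n} and assume P is nondegenerate. Then P is a simple polytope if and only if the full-dimensional polytope P ∩ C_K is simple. -/

import Mathlib

open scoped RealInnerProductSpace

noncomputable section

variable {V : Type*} [NormedAddCommGroup V] [InnerProductSpace ℝ V]

/-- The reflection `r_α` across the hyperplane orthogonal to `α`:
`r_α(x) = x − (2⟪x,α⟫/⟪α,α⟫) α`. -/
def reflMap (α : V) : V → V := fun x => x - (2 * ⟪x, α⟫ / ⟪α, α⟫) • α

/-- The hyperplane `H_α = {x | ⟪x, α⟫ = 0}` fixed by `reflMap α`. -/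
def hplane (α : V) : Set V := {x : V | ⟪x, α⟫ = 0}

/-- `F` is a facet of the full-dimensional polytope `Q`: an exposed face whose affine
span has dimension `n − 1` (where `n = dim V`). -/
def IsFacet (Q F : Set V) : Prop :=
  IsExposed ℝ Q F ∧ Module.finrank ℝ (affineSpan ℝ F).direction + 1 = Module.finrank ℝ V

open Classical in
/-- The barycenter of a nonempty face: the centroid of its finitely many extreme points. -/
def barycenter (F : Set V) : V :=
  if h : (Set.extremePoints ℝ F).Finite then h.toFinset.centroid ℝ id else 0

/-- A full-dimensional polytope is simple if every extreme point lies in exactly `n` facets. -/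
def IsSimple (Q : Set V) : Prop :=
  ∀ v ∈ Set.extremePoints ℝ Q, {F : Set V | IsFacet Q F ∧ v ∈ F}.ncard = Module.finrank ℝ V

/-- The cone `C_K = {x | ⟪x, α_k⟫ ≥ 0 for all k ∈ K}`. -/
def cham {n : ℕ} (α : Fin n → V) (K : Set (Fin n)) : Set V :=
  {x : V | ∀ k ∈ K, 0 ≤ ⟪x, α k⟫}

/-- The parabolic subgroup `W_K`, realized as the submonoid of `Function.End V`
generated by the simple reflections `r_{α_k}`, `k ∈ K` (since each generator is an
involution, this submonoid coincides with the generated group). -/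
def WK {n : ℕ} (α : Fin n → V) (K : Set (Fin n)) : Submonoid (Function.End V) :=
  Submonoid.closure {g : Function.End V | ∃ k ∈ K, g = reflMap (α k)}

/-- A reduced root system of full rank `n` in `V` with a fixed simple system `α`. -/
structure RootSystemData (V : Type*) [NormedAddCommGroup V] [InnerProductSpace ℝ V]
    (n : ℕ) : Type _ where
  α : Fin n → V
  R : Set V
  hn : 1 ≤ n
  hdim : Module.finrank ℝ V = n
  hR_fin : R.Finite
  hR_ne0 : ∀ β ∈ R, β ≠ 0
  hR_refl : ∀ β ∈ R, reflMap β '' R = R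
  hR_red : ∀ β ∈ R, R ∩ {x : V | ∃ c : ℝ, x = c • β} = {β, -β}
  hα_mem : ∀ i, α i ∈ R
  hα_indep : LinearIndependent ℝ α
  hα_span : Submodule.span ℝ (Set.range α) = ⊤
  hα_sign : ∀ β ∈ R, ∃ c : Fin n → ℝ, β = ∑ i, c i • α i ∧
    ((∀ i, 0 ≤ c i) ∨ (∀ i, c i ≤ 0))

/-- A `W`-symmetric polytope datum: a root system together with a finite nonempty
set `Λ` contained in the fundamental chamber `C_S`. -/
structure PermSetup (V : Type*) [NormedAddCommGroup V] [InnerProductSpace ℝ V]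
    (n : ℕ) extends RootSystemData V n where
  Λ : Set V
  hΛ_fin : Λ.Finite
  hΛ_ne : Λ.Nonempty
  hΛ_cham : Λ ⊆ cham α Set.univ

/-- The `W`-symmetric polytope `P = conv(⋃_{w ∈ W} w(Λ))`. -/
def PermSetup.P {n : ℕ} (S : PermSetup V n) : Set V :=
  convexHull ℝ (⋃ w ∈ WK S.α Set.univ, Set.image w S.Λ)

/-- `P` is nondegenerate: `⟪λ, α_i⟫ > 0` for every `λ ∈ Λ` and every `i`. -/
def PermSetup.Nondegenerate {n : ℕ} (S : PermSetup V n) : Prop :=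
  ∀ l ∈ S.Λ, ∀ i, 0 < ⟪l, S.α i⟫

/-! ### Polar duality for polyhedra -/

/-- The polar dual of `Q` with respect to the base point `c`. -/
def polarAt (c : V) (Q : Set V) : Set V := {l | ∀ y ∈ Q, ⟪l, y - c⟫ ≤ 1}

/-- The intersection of the half-spaces `⟪g, y - c⟫ ≤ 1`, `g ∈ G`. -/
def halfspaces (c : V) (G : Set V) : Set V := {y | ∀ g ∈ G, ⟪g, y - c⟫ ≤ 1}

lemma exists_inner_eq [FiniteDimensional ℝ V] (f : StrongDual ℝ V) :
    ∃ z : V, ∀ y, f y = ⟪z, y⟫ :=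
  ⟨(InnerProductSpace.toDual ℝ V).symm f, by simp⟩

lemma convex_polarAt (c : V) (Q : Set V) : Convex ℝ (polarAt c Q) := by
  intro a ha b hb s t hs ht hst y hy
  have h1 := ha y hy
  have h2 := hb y hy
  rw [inner_add_left, real_inner_smul_left, real_inner_smul_left]
  nlinarith

lemma isClosed_polarAt (c : V) (Q : Set V) : IsClosed (polarAt c Q) := by
  have : polarAt c Q = ⋂ y ∈ Q, {l : V | ⟪l, y - c⟫ ≤ 1} := by
    ext l; simp [polarAt]
  rw [this]
  exact isClosed_biInter fun y _ => isClosed_le (by fun_prop) continuous_const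

lemma zero_mem_polarAt (c : V) (Q : Set V) : (0 : V) ∈ polarAt c Q := by
  intro y _; simp

/-- A supporting functional is strictly larger at its maximum than at an interior point. -/
lemma inner_lt_of_mem_interior {c z x : V} {Q : Set V} (hc : c ∈ interior Q) (hz : z ≠ 0)
    (hmax : ∀ y ∈ Q, ⟪z, y⟫ ≤ ⟪z, x⟫) : ⟪z, c⟫ < ⟪z, x⟫ := by
  have hcont : Filter.Tendsto (fun t : ℝ => c + t • z) (nhds 0) (nhds c) := by
    have : Continuous fun t : ℝ => c + t • z := by fun_prop
    simpa using this.tendsto 0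
  have hev := hcont.eventually (mem_interior_iff_mem_nhds.1 hc)
  obtain ⟨t, ht, ht0⟩ :=
    ((hev.filter_mono nhdsWithin_le_nhds).and (self_mem_nhdsWithin (s := Set.Ioi (0 : ℝ)))).exists
  have h := hmax _ ht
  rw [inner_add_right, real_inner_smul_right] at h
  have : 0 < t * ⟪z, z⟫ := mul_pos ht0 (real_inner_self_pos.2 hz)
  linarith

lemma isCompact_polarAt [FiniteDimensional ℝ V] {c : V} {Q : Set V} (hc : c ∈ interior Q) :
    IsCompact (polarAt c Q) := by
  obtain ⟨ε, hε, hball⟩ := Metric.isOpen_iff.1 isOpen_interior c hc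
  refine Metric.isCompact_of_isClosed_isBounded (isClosed_polarAt c Q) ?_
  refine isBounded_iff_forall_norm_le.2 ⟨2 / ε, fun l hl => ?_⟩
  rcases eq_or_ne l 0 with rfl | hl0
  · simp; positivity
  have hn : 0 < ‖l‖ := norm_pos_iff.2 hl0
  have hmem : c + (ε / 2 / ‖l‖) • l ∈ Q := by
    refine interior_subset (hball ?_)
    rw [Metric.mem_ball, dist_eq_norm, add_sub_cancel_left, norm_smul, Real.norm_eq_abs,
      abs_of_pos (by positivity), div_mul_cancel₀ _ hn.ne']
    linarith
  have h := hl _ hmem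
  rw [add_sub_cancel_left, real_inner_smul_right, real_inner_self_eq_norm_sq] at h
  have h2 : ε / 2 / ‖l‖ * ‖l‖ ^ 2 = ε / 2 * ‖l‖ := by field_simp
  rw [h2] at h
  rw [le_div_iff₀ hε]
  linarith

/-- A closed convex set is cut out by the extreme points of its polar dual. -/
lemma halfspaces_extremePoints_polarAt [FiniteDimensional ℝ V] {c : V} {Q : Set V}
    (hc : c ∈ interior Q) (hcl : IsClosed Q) (hcv : Convex ℝ Q) :
    halfspaces c (Set.extremePoints ℝ (polarAt c Q)) = Q := by
  apply Set.Subset.antisymm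
  · intro y hy
    have hall : ∀ l ∈ polarAt c Q, ⟪l, y - c⟫ ≤ 1 := by
      have hsub : closure (convexHull ℝ (Set.extremePoints ℝ (polarAt c Q))) ⊆
          polarAt c {y} := by
        refine closure_minimal (convexHull_min ?_ (convex_polarAt _ _)) (isClosed_polarAt _ _)
        intro l hl y' hy'
        rw [Set.mem_singleton_iff.1 hy']
        exact hy l hl
      rw [closure_convexHull_extremePoints (isCompact_polarAt hc) (convex_polarAt c Q)] at hsub
      exact fun l hl => hsub hl y rfl
    by_contra hyQ
    obtain ⟨f, u, hf, hu⟩ := geometric_hahn_banach_closed_point hcv hcl hyQ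
    obtain ⟨z, hz⟩ := exists_inner_eq f
    have hcu := hf c (interior_subset hc)
    have hpos : 0 < u - f c := sub_pos.2 hcu
    have hmem : (u - f c)⁻¹ • z ∈ polarAt c Q := by
      intro p hp
      have := hf p hp
      rw [real_inner_smul_left, inner_sub_right, ← hz, ← hz, inv_mul_le_iff₀ hpos]
      linarith
    have := hall _ hmem
    rw [real_inner_smul_left, inner_sub_right, ← hz, ← hz, inv_mul_le_iff₀ hpos] at this
    linarith
  · intro y hy l hl
    exact hl.1 y hy

lemma polarAt_halfspaces_subset [FiniteDimensional ℝ V] (c : V) {G : Set V} (hG : G.Finite) :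
    polarAt c (halfspaces c G) ⊆ convexHull ℝ (insert 0 G) := by
  intro l hl
  by_contra hln
  obtain ⟨f, u, hf, hu⟩ := geometric_hahn_banach_closed_point (convex_convexHull ℝ _)
    ((hG.insert 0).isClosed_convexHull ℝ) hln
  obtain ⟨z, hz⟩ := exists_inner_eq f
  have hu0 : 0 < u := by
    simpa using hf 0 (subset_convexHull ℝ _ (Set.mem_insert _ _))
  have hmem : c + u⁻¹ • z ∈ halfspaces c G := by
    intro g hg
    have := hf g (subset_convexHull ℝ _ (Set.mem_insert_of_mem _ hg))
    rw [add_sub_cancel_left, real_inner_smul_right, real_inner_comm, ← hz, inv_mul_le_iff₀ hu0]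
    linarith
  have := hl _ hmem
  rw [add_sub_cancel_left, real_inner_smul_right, real_inner_comm, ← hz,
    inv_mul_le_iff₀ hu0] at this
  linarith

lemma extremePoints_polarAt_halfspaces_subset [FiniteDimensional ℝ V] (c : V) {G : Set V}
    (hG : G.Finite) :
    Set.extremePoints ℝ (polarAt c (halfspaces c G)) ⊆ insert 0 G := by
  have h : polarAt c (halfspaces c G) = convexHull ℝ (insert 0 G) := by
    refine (polarAt_halfspaces_subset c hG).antisymm (convexHull_min ?_ (convex_polarAt _ _))
    rintro l (rfl | hl)
    · exact zero_mem_polarAt _ _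
    · exact fun y hy => hy l hl
  rw [h]
  exact extremePoints_convexHull_subset

/-- Points near `x` in a direction orthogonal to the active constraints stay feasible. -/
lemma eventually_add_smul_mem_halfspaces {c x w : V} {G : Set V} (hG : G.Finite)
    (hx : x ∈ halfspaces c G) (hw : ∀ g ∈ G, ⟪g, x - c⟫ = 1 → ⟪g, w⟫ = 0) :
    ∀ᶠ t : ℝ in nhds 0, x + t • w ∈ halfspaces c G := by
  refine (hG.eventually_all (l := nhds (0 : ℝ))
    (p := fun g t => ⟪g, x + t • w - c⟫ ≤ 1)).2 fun g hg => ?_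
  rcases (hx g hg).eq_or_lt with h | h
  · refine Filter.Eventually.of_forall fun t => ?_
    rw [add_sub_right_comm, inner_add_right, real_inner_smul_right, hw g hg h, h]
    simp
  · have hcont : Continuous fun t : ℝ => ⟪g, x + t • w - c⟫ := by fun_prop
    have := (hcont.tendsto 0).eventually_lt_const (u := 1) (by simpa using h)
    exact this.mono fun t ht => ht.le

/-- At a vertex the active constraints span. -/
lemma span_active_eq_top [FiniteDimensional ℝ V] {c x : V} {G : Set V} (hG : G.Finite)
    (hx : x ∈ Set.extremePoints ℝ (halfspaces c G)) :
    Submodule.span ℝ {g ∈ G | ⟪g, x - c⟫ = 1} = ⊤ := by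
  rw [← Submodule.orthogonal_eq_bot_iff, Submodule.eq_bot_iff]
  intro w hw
  have hw' : ∀ g ∈ G, ⟪g, x - c⟫ = 1 → ⟪g, w⟫ = 0 := fun g hg h =>
    (Submodule.mem_orthogonal _ _).1 hw g (Submodule.subset_span ⟨hg, h⟩)
  have h1 := eventually_add_smul_mem_halfspaces hG hx.1 hw'
  have h2 := eventually_add_smul_mem_halfspaces (w := -w) hG hx.1
    fun g hg h => by rw [inner_neg_right, hw' g hg h, neg_zero]
  obtain ⟨t, ⟨ht1, ht2⟩, ht0⟩ := (((h1.and h2).filter_mono nhdsWithin_le_nhds).and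
    (self_mem_nhdsWithin (s := Set.Ioi (0 : ℝ)))).exists
  have hseg : x ∈ openSegment ℝ (x + t • w) (x + t • -w) := by
    refine ⟨1 / 2, 1 / 2, by norm_num, by norm_num, by norm_num, ?_⟩
    module
  have := ((mem_extremePoints.1 hx).2 _ ht1 _ ht2 hseg).1
  have h3 : t • w = 0 := by simpa using this
  exact (smul_eq_zero.1 h3).resolve_left (ne_of_gt ht0)

lemma finite_extremePoints_halfspaces [FiniteDimensional ℝ V] (c : V) {G : Set V}
    (hG : G.Finite) : (Set.extremePoints ℝ (halfspaces c G)).Finite := by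
  refine Set.Finite.of_finite_image (f := fun x => {g ∈ G | ⟪g, x - c⟫ = 1})
    (hG.finite_subsets.subset ?_) ?_
  · rintro _ ⟨x, _, rfl⟩
    exact Set.sep_subset _ _
  · intro x hx y hy hxy
    have hspan := span_active_eq_top hG hx
    have hperp : ∀ g ∈ G, ⟪g, x - c⟫ = 1 → ⟪g, x - y⟫ = 0 := by
      intro g hg h
      have hmem : g ∈ {g ∈ G | ⟪g, y - c⟫ = 1} := by
        have : g ∈ {g ∈ G | ⟪g, x - c⟫ = 1} := ⟨hg, h⟩
        simpa only [hxy] using this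
      rw [← sub_sub_sub_cancel_right x y c, inner_sub_right, h, hmem.2, sub_self]
    have : x - y ∈ (Submodule.span ℝ {g ∈ G | ⟪g, x - c⟫ = 1})ᗮ := by
      rw [Submodule.mem_orthogonal]
      intro u hu
      induction hu using Submodule.span_induction with
      | mem g hg => exact hperp g hg.1 hg.2
      | zero => simp
      | add a b _ _ ha hb => rw [inner_add_left, ha, hb, add_zero]
      | smul r a _ ha => rw [real_inner_smul_left, ha, mul_zero]
    rw [hspan, Submodule.top_orthogonal_eq_bot, Submodule.mem_bot] at this
    exact sub_eq_zero.1 this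

/-- The polar dual of a convex hull of finitely many points has finitely many vertices. -/
lemma finite_extremePoints_polarAt_convexHull [FiniteDimensional ℝ V] (c : V) {E : Set V}
    (hE : E.Finite) : (Set.extremePoints ℝ (polarAt c (convexHull ℝ E))).Finite := by
  have h : polarAt c (convexHull ℝ E) = halfspaces 0 ((fun e => e - c) '' E) := by
    ext l
    constructor
    · rintro hl _ ⟨e, he, rfl⟩
      simpa [real_inner_comm] using hl e (subset_convexHull ℝ _ he)
    · intro hl
      have hcv : Convex ℝ (halfspaces c {l}) := by
        intro a ha b hb s t hs ht hst g hg
        have h1 := ha g hg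
        have h2 := hb g hg
        have : s • a + t • b - c = s • (a - c) + t • (b - c) := by
          rw [smul_sub, smul_sub, sub_add_sub_comm, ← add_smul, hst, one_smul]
        rw [this, inner_add_right, real_inner_smul_right, real_inner_smul_right]
        nlinarith
      have hsub : convexHull ℝ E ⊆ halfspaces c {l} := by
        refine convexHull_min (fun e he g hg => ?_) hcv
        rw [Set.mem_singleton_iff.1 hg]
        simpa [real_inner_comm] using hl (e - c) ⟨e, he, rfl⟩
      exact fun y hy => hsub hy l rfl
  rw [h]
  exact finite_extremePoints_halfspaces 0 (hE.image _)

/-! ### Facets as vertices of the polar dual -/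

/-- A linear functional equal to `1` on a set of codimension one is unique. -/
lemma eq_of_inner_eq_one_on_codim_one [FiniteDimensional ℝ V] {c l a : V} {F : Set V}
    (hdim : Module.finrank ℝ (affineSpan ℝ F).direction + 1 = Module.finrank ℝ V)
    (hne : F.Nonempty) (hl : ∀ y ∈ F, ⟪l, y - c⟫ = 1) (ha : ∀ y ∈ F, ⟪a, y - c⟫ = 1) :
    a = l := by
  obtain ⟨x, hx⟩ := hne
  set D := (affineSpan ℝ F).direction with hD
  have hperp : ∀ b : V, (∀ y ∈ F, ⟪b, y - c⟫ = 1) → b ∈ Dᗮ := by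
    intro b hb
    rw [Submodule.mem_orthogonal, hD, direction_affineSpan, vectorSpan_eq_span_vsub_set_right ℝ hx]
    intro u hu
    induction hu using Submodule.span_induction with
    | mem g hg =>
      obtain ⟨y, hy, rfl⟩ := hg
      simp only [vsub_eq_sub]
      rw [real_inner_comm, ← sub_sub_sub_cancel_right y x c, inner_sub_right, hb y hy, hb x hx,
        sub_self]
    | zero => simp
    | add a b _ _ ha hb => rw [inner_add_left, ha, hb, add_zero]
    | smul r a _ ha => rw [real_inner_smul_left, ha, mul_zero]
  have h1 : Module.finrank ℝ Dᗮ = 1 := by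
    have := Submodule.finrank_add_finrank_orthogonal D
    omega
  have hlne : (⟨l, hperp l hl⟩ : Dᗮ) ≠ 0 := by
    intro h
    have h0 : l = 0 := congrArg Subtype.val h
    have := hl x hx
    rw [h0, inner_zero_left] at this
    exact zero_ne_one this
  obtain ⟨t, ht⟩ := (finrank_eq_one_iff_of_nonzero' _ hlne).1 h1 ⟨a, hperp a ha⟩
  have ht' : t • l = a := congrArg Subtype.val ht
  have h2 := ha x hx
  rw [← ht', real_inner_smul_left, hl x hx, mul_one] at h2
  rw [← ht', h2, one_smul]

/-- Every nonzero vertex of the polar dual exposes a facet. -/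
lemma isFacet_of_mem_extremePoints_polarAt [FiniteDimensional ℝ V] {c a : V} {Q : Set V}
    (hc : c ∈ interior Q) (hcl : IsClosed Q) (hcv : Convex ℝ Q)
    (hfin : (Set.extremePoints ℝ (polarAt c Q)).Finite)
    (ha : a ∈ Set.extremePoints ℝ (polarAt c Q)) (ha0 : a ≠ 0) :
    IsFacet Q {y ∈ Q | ⟪a, y - c⟫ = 1} := by
  set X := Set.extremePoints ℝ (polarAt c Q) with hX
  have hQ : halfspaces c X = Q := halfspaces_extremePoints_polarAt hc hcl hcv
  have hnot : a ∉ convexHull ℝ (insert 0 (X \ {a})) := by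
    intro h
    refine ((convex_polarAt c Q).mem_extremePoints_iff_mem_sdiff_convexHull_sdiff.1 ha).2
      (convexHull_mono ?_ h)
    rintro l (rfl | hl)
    · exact ⟨zero_mem_polarAt _ _, fun h => ha0 h.symm⟩
    · exact ⟨hl.1.1, hl.2⟩
  obtain ⟨f, u, hf, hu⟩ := geometric_hahn_banach_closed_point (convex_convexHull ℝ _)
    (((hfin.subset Set.sdiff_subset).insert 0).isClosed_convexHull ℝ) hnot
  obtain ⟨p, hp⟩ := exists_inner_eq f
  have hu0 : 0 < u := by
    simpa using hf 0 (subset_convexHull ℝ _ (Set.mem_insert _ _))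
  have hfa : 0 < f a := hu0.trans hu
  set z := c + (f a)⁻¹ • p with hz
  have hza : ⟪a, z - c⟫ = 1 := by
    rw [hz, add_sub_cancel_left, real_inner_smul_right, real_inner_comm, ← hp,
      inv_mul_cancel₀ hfa.ne']
  have hzl : ∀ l ∈ X, l ≠ a → ⟪l, z - c⟫ < 1 := by
    intro l hl hla
    have := hf l (subset_convexHull ℝ _ (Set.mem_insert_of_mem _ ⟨hl, hla⟩))
    rw [hz, add_sub_cancel_left, real_inner_smul_right, real_inner_comm, ← hp,
      inv_mul_lt_iff₀ hfa]
    linarith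
  have hzX : z ∈ halfspaces c X := by
    intro l hl
    by_cases h : l = a
    · rw [h, hza]
    · exact (hzl l hl h).le
  have hzF : z ∈ {y ∈ Q | ⟪a, y - c⟫ = 1} := ⟨hQ ▸ hzX, hza⟩
  constructor
  · intro _
    refine ⟨innerSL ℝ a, ?_⟩
    ext y
    simp only [Set.mem_ofPred_eq, innerSL_apply_apply]
    refine and_congr_right fun hy => ⟨fun h y' hy' => ?_, fun h => ?_⟩
    · have := ha.1 y' hy'
      rw [inner_sub_right] at this h
      linarith
    · have h1 := h z hzF.1
      have h2 := ha.1 y hy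
      rw [inner_sub_right] at hza h2 ⊢
      linarith
  · have hdir : (affineSpan ℝ {y ∈ Q | ⟪a, y - c⟫ = 1}).direction = (ℝ ∙ a)ᗮ := by
      apply le_antisymm
      · rw [direction_affineSpan, vectorSpan_eq_span_vsub_set_right ℝ hzF, Submodule.span_le]
        rintro _ ⟨y, hy, rfl⟩
        rw [SetLike.mem_coe, Submodule.mem_orthogonal_singleton_iff_inner_right]
        simp only [vsub_eq_sub]
        rw [← sub_sub_sub_cancel_right y z c, inner_sub_right, hy.2, hza, sub_self]
      · intro w hw
        rw [Submodule.mem_orthogonal_singleton_iff_inner_right] at hw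
        have hev := eventually_add_smul_mem_halfspaces (w := w) hfin hzX (fun l hl h => by
          by_cases hla : l = a
          · rw [hla, hw]
          · exact absurd h (hzl l hl hla).ne)
        obtain ⟨t, ht, ht0⟩ := ((hev.filter_mono nhdsWithin_le_nhds).and
          (self_mem_nhdsWithin (s := Set.Ioi (0 : ℝ)))).exists
        have hmem : z + t • w ∈ {y ∈ Q | ⟪a, y - c⟫ = 1} := by
          refine ⟨hQ ▸ ht, ?_⟩
          rw [add_sub_right_comm, inner_add_right, hza, real_inner_smul_right, hw]
          simp
        have hv := vsub_mem_vectorSpan ℝ hmem hzF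
        rw [← direction_affineSpan, vsub_eq_sub, add_sub_cancel_left] at hv
        exact (Submodule.smul_mem_iff _ (ne_of_gt ht0)).1 hv
    rw [hdir]
    have := Submodule.finrank_add_finrank_orthogonal (ℝ ∙ a)
    rw [finrank_span_singleton ha0] at this
    omega

/-- Every facet is exposed by a vertex of the polar dual. -/
lemma IsFacet.exists_extremePoint_polarAt [FiniteDimensional ℝ V] {c : V} {Q F : Set V}
    (hc : c ∈ interior Q) (hF : IsFacet Q F) (hne : F.Nonempty) :
    ∃ l ∈ Set.extremePoints ℝ (polarAt c Q), F = {y ∈ Q | ⟪l, y - c⟫ = 1} := by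
  obtain ⟨hexp, hdim⟩ := hF
  obtain ⟨f, hf⟩ := hexp hne
  obtain ⟨x, hx⟩ := hne
  obtain ⟨z, hz⟩ := exists_inner_eq f
  have hxQ : x ∈ Q ∧ ∀ y ∈ Q, f y ≤ f x := by rw [hf] at hx; exact hx
  have hz0 : z ≠ 0 := by
    rintro rfl
    have hFQ : F = Q := by
      rw [hf]; ext y; simp [hz]
    have htop : affineSpan ℝ F = ⊤ := by
      rw [hFQ, eq_top_iff, ← isOpen_interior.affineSpan_eq_top ⟨c, hc⟩]
      exact affineSpan_mono ℝ interior_subset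
    rw [htop, AffineSubspace.direction_top, finrank_top] at hdim
    omega
  have hlt : f c < f x := by
    rw [hz, hz]
    exact inner_lt_of_mem_interior hc hz0 fun y hy => by
      rw [← hz, ← hz]; exact hxQ.2 y hy
  have hpos : 0 < f x - f c := sub_pos.2 hlt
  set l := (f x - f c)⁻¹ • z with hl
  have hle : ∀ y, ⟪l, y - c⟫ = (f y - f c) / (f x - f c) := by
    intro y
    rw [hl, real_inner_smul_left, inner_sub_right, ← hz, ← hz]
    ring
  have hFl : F = {y ∈ Q | ⟪l, y - c⟫ = 1} := by
    rw [hf]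
    ext y
    simp only [Set.mem_ofPred_eq, hle, div_eq_one_iff_eq hpos.ne']
    refine and_congr_right fun hy => ⟨fun h => ?_, fun h y' hy' => ?_⟩
    · have := h x hxQ.1
      have := hxQ.2 y hy
      linarith
    · have := hxQ.2 y' hy'
      linarith
  refine ⟨l, mem_extremePoints.2 ⟨fun y hy => ?_, fun a ha b hb hab => ?_⟩, hFl⟩
  · rw [hle, div_le_one hpos]
    linarith [hxQ.2 y hy]
  · have hl1 : ∀ y ∈ F, ⟪l, y - c⟫ = 1 := fun y hy => by rw [hFl] at hy; exact hy.2
    obtain ⟨s, t, hs, ht, hst, hsum⟩ := hab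
    have hboth : ∀ y ∈ F, ⟪a, y - c⟫ = 1 ∧ ⟪b, y - c⟫ = 1 := by
      intro y hy
      have h1 := hl1 y hy
      have hyQ : y ∈ Q := by rw [hFl] at hy; exact hy.1
      have h2 := ha y hyQ
      have h3 := hb y hyQ
      rw [← hsum, inner_add_left, real_inner_smul_left, real_inner_smul_left] at h1
      constructor <;> nlinarith
    exact ⟨eq_of_inner_eq_one_on_codim_one hdim ⟨x, hx⟩ hl1 fun y hy => (hboth y hy).1,
      eq_of_inner_eq_one_on_codim_one hdim ⟨x, hx⟩ hl1 fun y hy => (hboth y hy).2⟩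

/-- Facets through `x` correspond to vertices of the polar dual active at `x`. -/
lemma ncard_facets_eq [FiniteDimensional ℝ V] {c x : V} {Q : Set V}
    (hc : c ∈ interior Q) (hcl : IsClosed Q) (hcv : Convex ℝ Q)
    (hfin : (Set.extremePoints ℝ (polarAt c Q)).Finite) (hx : x ∈ Q) :
    {F : Set V | IsFacet Q F ∧ x ∈ F}.ncard =
      {l ∈ Set.extremePoints ℝ (polarAt c Q) | ⟪l, x - c⟫ = 1}.ncard := by
  have hfacet : ∀ l ∈ {l ∈ Set.extremePoints ℝ (polarAt c Q) | ⟪l, x - c⟫ = 1},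
      IsFacet Q {y ∈ Q | ⟪l, y - c⟫ = 1} := by
    rintro l ⟨hl, hlx⟩
    refine isFacet_of_mem_extremePoints_polarAt hc hcl hcv hfin hl ?_
    rintro rfl
    simp at hlx
  have himg : {F : Set V | IsFacet Q F ∧ x ∈ F} =
      (fun l => {y ∈ Q | ⟪l, y - c⟫ = 1}) ''
        {l ∈ Set.extremePoints ℝ (polarAt c Q) | ⟪l, x - c⟫ = 1} := by
    ext F
    constructor
    · rintro ⟨hF, hxF⟩
      obtain ⟨l, hl, rfl⟩ := hF.exists_extremePoint_polarAt hc ⟨x, hxF⟩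
      exact ⟨l, ⟨hl, hxF.2⟩, rfl⟩
    · rintro ⟨l, hl, rfl⟩
      exact ⟨hfacet l hl, hx, hl.2⟩
  rw [himg, Set.InjOn.ncard_image]
  intro l hl a ha hla
  refine (eq_of_inner_eq_one_on_codim_one (hfacet l hl).2 ⟨x, hx, hl.2⟩ (fun y hy => hy.2)
    fun y hy => ?_).symm
  have hy' : y ∈ {y ∈ Q | ⟪a, y - c⟫ = 1} := by
    rw [← show {y ∈ Q | ⟪l, y - c⟫ = 1} = {y ∈ Q | ⟪a, y - c⟫ = 1} from hla]; exact hy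
  exact hy'.2

/-! ### Symmetries -/

lemma IsFacet.image (e : V ≃ₗᵢ[ℝ] V) {Q F : Set V} (hF : IsFacet Q F) :
    IsFacet (e '' Q) (e '' F) := by
  obtain ⟨hexp, hdim⟩ := hF
  constructor
  · intro hne
    obtain ⟨l, hl⟩ := hexp (Set.image_nonempty.1 hne)
    refine ⟨l.comp (e.symm.toContinuousLinearEquiv : V →L[ℝ] V), ?_⟩
    ext y
    constructor
    · rintro ⟨x, hx, rfl⟩
      rw [hl] at hx
      refine ⟨⟨x, hx.1, rfl⟩, ?_⟩
      rintro _ ⟨y, hy, rfl⟩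
      simpa using hx.2 y hy
    · rintro ⟨⟨x, hx, rfl⟩, hmax⟩
      refine ⟨x, ?_, rfl⟩
      rw [hl]
      refine ⟨hx, fun y hy => ?_⟩
      simpa using hmax (e y) ⟨y, hy, rfl⟩
  · have h : vectorSpan ℝ (e '' F) = (vectorSpan ℝ F).map (e.toLinearEquiv : V →ₗ[ℝ] V) :=
      ((e.toLinearEquiv : V →ₗ[ℝ] V).toAffineMap.map_vectorSpan (s := F)).symm
    rw [direction_affineSpan] at hdim ⊢
    rw [h, LinearEquiv.finrank_map_eq, hdim]

lemma ncard_facets_map (e : V ≃ₗᵢ[ℝ] V) {Q : Set V} (he : e '' Q = Q) (v : V) :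
    {F : Set V | IsFacet Q F ∧ e v ∈ F}.ncard = {F : Set V | IsFacet Q F ∧ v ∈ F}.ncard := by
  have hes : e.symm '' Q = Q := by
    conv_lhs => rw [← he]
    simp [Set.image_image]
  have himg : {F : Set V | IsFacet Q F ∧ e v ∈ F} =
      Set.image e '' {F : Set V | IsFacet Q F ∧ v ∈ F} := by
    ext F
    constructor
    · rintro ⟨hF, hv⟩
      refine ⟨e.symm '' F, ⟨?_, e v, hv, by simp⟩, by simp [Set.image_image]⟩
      have := hF.image e.symm
      rwa [hes] at this
    · rintro ⟨F, ⟨hF, hv⟩, rfl⟩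
      refine ⟨?_, v, hv, rfl⟩
      have := hF.image e
      rwa [he] at this
  rw [himg, (e.injective.image_injective.injOn).ncard_image]

lemma exists_linearIsometryEquiv_eq_reflMap [FiniteDimensional ℝ V] (β : V) :
    ∃ e : V ≃ₗᵢ[ℝ] V, ⇑e = reflMap β := by
  refine ⟨(ℝ ∙ β)ᗮ.reflection, ?_⟩
  ext x
  rw [Submodule.reflection_orthogonal_apply, Submodule.reflection_singleton_apply, reflMap,
    real_inner_self_eq_norm_sq, real_inner_comm]
  simp only [RCLike.ofReal_real_eq_id, id_eq]
  module

lemma reflMap_reflMap (β x : V) : reflMap β (reflMap β x) = x := by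
  rcases eq_or_ne β 0 with rfl | hβ
  · simp [reflMap]
  · have : ⟪β, β⟫ ≠ 0 := (real_inner_self_pos.2 hβ).ne'
    simp only [reflMap, inner_sub_left, real_inner_smul_left, div_mul_cancel₀ _ this]
    rw [show 2 * (⟪x, β⟫ - 2 * ⟪x, β⟫) / ⟪β, β⟫ = -(2 * ⟪x, β⟫ / ⟪β, β⟫) by ring]
    module

namespace PermSetup

variable {n : ℕ}

/-- The generating set `⋃_{w ∈ W} w(Λ)` of `P`. -/
def orbit (S : PermSetup V n) : Set V := ⋃ w ∈ WK S.α Set.univ, Set.image w S.Λ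

lemma P_eq (S : PermSetup V n) : S.P = convexHull ℝ S.orbit := rfl

lemma reflMap_mem_WK (S : PermSetup V n) (k : Fin n) :
    (reflMap (S.α k) : Function.End V) ∈ WK S.α Set.univ :=
  Submonoid.subset_closure ⟨k, trivial, rfl⟩

lemma reflMap_image_orbit (S : PermSetup V n) (k : Fin n) :
    reflMap (S.α k) '' S.orbit = S.orbit := by
  have hsub : ∀ y ∈ S.orbit, reflMap (S.α k) y ∈ S.orbit := by
    intro y hy
    simp only [orbit, Set.mem_iUnion] at hy ⊢
    obtain ⟨w, hw, l, hl, rfl⟩ := hy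
    exact ⟨_,
      Submonoid.mul_mem _ (S.reflMap_mem_WK k) hw, l, hl, rfl⟩
  apply Set.Subset.antisymm
  · rintro _ ⟨y, hy, rfl⟩
    exact hsub y hy
  · intro y hy
    exact ⟨_, hsub y hy, reflMap_reflMap _ _⟩

/-- Every element of `W` is a linear isometry preserving the roots and the orbit of `Λ`. -/
lemma exists_isometry_of_mem_WK [FiniteDimensional ℝ V] (S : PermSetup V n)
    {w : Function.End V} (hw : w ∈ WK S.α Set.univ) :
    ∃ e : V ≃ₗᵢ[ℝ] V, ⇑e = w ∧ e '' S.orbit = S.orbit ∧ e '' S.R = S.R := by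
  induction hw using Submonoid.closure_induction with
  | mem w hw =>
    obtain ⟨k, _, rfl⟩ := hw
    obtain ⟨e, he⟩ := exists_linearIsometryEquiv_eq_reflMap (S.α k)
    exact ⟨e, he, he ▸ S.reflMap_image_orbit k, he ▸ S.hR_refl _ (S.hα_mem k)⟩
  | one => exact ⟨LinearIsometryEquiv.refl ℝ V, rfl, by simp, by simp⟩
  | mul a b _ _ ha hb =>
    obtain ⟨e, rfl, he1, he2⟩ := ha
    obtain ⟨f, rfl, hf1, hf2⟩ := hb
    refine ⟨f.trans e, rfl, ?_, ?_⟩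
    · rw [LinearIsometryEquiv.coe_trans, Set.image_comp, hf1, he1]
    · rw [LinearIsometryEquiv.coe_trans, Set.image_comp, hf2, he2]

lemma finite_WK [FiniteDimensional ℝ V] (S : PermSetup V n) :
    (WK S.α Set.univ : Set (Function.End V)).Finite := by
  refine Set.Finite.of_finite_image (f := fun w => fun i => w (S.α i))
    ((Set.Finite.pi' (t := fun _ : Fin n => S.R) fun _ => S.hR_fin).subset ?_) ?_
  · rintro _ ⟨w, hw, rfl⟩ i
    obtain ⟨e, rfl, _, heR⟩ := S.exists_isometry_of_mem_WK hw
    exact heR ▸ Set.mem_image_of_mem e (S.hα_mem i)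
  · intro w hw w' hw' h
    obtain ⟨e, rfl, _, _⟩ := S.exists_isometry_of_mem_WK hw
    obtain ⟨f, rfl, _, _⟩ := S.exists_isometry_of_mem_WK hw'
    have hlin : (e.toLinearEquiv : V →ₗ[ℝ] V) = f.toLinearEquiv :=
      LinearMap.ext_on_range S.hα_span fun i => congrFun h i
    funext x
    exact LinearMap.congr_fun hlin x

lemma finite_orbit [FiniteDimensional ℝ V] (S : PermSetup V n) : S.orbit.Finite :=
  S.finite_WK.biUnion fun _ _ => S.hΛ_fin.image _

lemma Λ_subset_orbit (S : PermSetup V n) : S.Λ ⊆ S.orbit := fun l hl =>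
  Set.mem_biUnion (Submonoid.one_mem (WK S.α Set.univ)) ⟨l, hl, rfl⟩

lemma isCompact_P [FiniteDimensional ℝ V] (S : PermSetup V n) : IsCompact S.P :=
  S.finite_orbit.isCompact_convexHull ℝ

lemma convex_P (S : PermSetup V n) : Convex ℝ S.P := convex_convexHull ℝ _

lemma image_P (S : PermSetup V n) (e : V ≃ₗᵢ[ℝ] V) (he : e '' S.orbit = S.orbit) :
    e '' S.P = S.P := by
  have := (e.toLinearEquiv : V →ₗ[ℝ] V).image_convexHull S.orbit
  rw [P_eq]
  refine Eq.trans this ?_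
  exact congrArg (convexHull ℝ) he

lemma reflMap_mem_P [FiniteDimensional ℝ V] (S : PermSetup V n) (k : Fin n) {y : V}
    (hy : y ∈ S.P) : reflMap (S.α k) y ∈ S.P := by
  obtain ⟨e, he, heo, _⟩ := S.exists_isometry_of_mem_WK (S.reflMap_mem_WK k)
  rw [← S.image_P e heo]
  exact ⟨y, hy, congrFun he y⟩

/-- For nondegenerate `P` no point of the orbit of `Λ` lies on a root hyperplane. -/
lemma Nondegenerate.inner_ne_zero [FiniteDimensional ℝ V] {S : PermSetup V n}
    (hnd : S.Nondegenerate) {y β : V} (hy : y ∈ S.orbit) (hβ : β ∈ S.R) : ⟪y, β⟫ ≠ 0 := by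
  have hbase : ∀ l ∈ S.Λ, ∀ β ∈ S.R, ⟪l, β⟫ ≠ 0 := by
    intro l hl β hβ
    obtain ⟨a, ha, hsign⟩ := S.hα_sign β hβ
    have hsum : ⟪l, β⟫ = ∑ i, a i * ⟪l, S.α i⟫ := by
      rw [ha, inner_sum]
      simp [real_inner_smul_right]
    have hex : ∃ i, a i ≠ 0 := by
      by_contra! h
      exact S.hR_ne0 β hβ (by rw [ha]; simp [h])
    obtain ⟨i, hi⟩ := hex
    rw [hsum]
    rcases hsign with h | h
    · refine (Finset.sum_pos' (fun j _ => mul_nonneg (h j) (hnd l hl j).le)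
        ⟨i, Finset.mem_univ _, mul_pos ((h i).lt_of_ne' hi) (hnd l hl i)⟩).ne'
    · refine (Finset.sum_neg' (fun j _ => mul_nonpos_of_nonpos_of_nonneg (h j) (hnd l hl j).le)
        ⟨i, Finset.mem_univ _, mul_neg_of_neg_of_pos ((h i).lt_of_ne hi) (hnd l hl i)⟩).ne
  simp only [orbit, Set.mem_iUnion] at hy
  obtain ⟨w, hw, l, hl, rfl⟩ := hy
  obtain ⟨e, rfl, _, heR⟩ := S.exists_isometry_of_mem_WK hw
  rw [← heR] at hβ
  obtain ⟨γ, hγ, rfl⟩ := hβ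
  rw [e.inner_map_map]
  exact hbase l hl γ hγ

/-- For nondegenerate `P`, supporting functionals at a point of the wall of `α_k` are orthogonal
to `α_k`. -/
lemma Nondegenerate.inner_eq_zero_of_isMax [FiniteDimensional ℝ V] {S : PermSetup V n}
    (hnd : S.Nondegenerate) {p x : V} {k : Fin n} (hx : x ∈ S.P) (hxk : ⟪x, S.α k⟫ = 0)
    (hp : ∀ y ∈ S.P, ⟪p, y⟫ ≤ ⟪p, x⟫) : ⟪p, S.α k⟫ = 0 := by
  have hα : ⟪S.α k, S.α k⟫ ≠ 0 := (real_inner_self_pos.2 (S.hR_ne0 _ (S.hα_mem k))).ne'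
  set f : V →ₗ[ℝ] ℝ := (innerₛₗ ℝ (p + reflMap (S.α k) p)) with hf
  have hfv : ∀ y, f y = ⟪p, y⟫ + ⟪p, reflMap (S.α k) y⟫ := by
    intro y
    simp only [hf, reflMap, innerₛₗ_apply_apply, inner_add_left, inner_sub_left, inner_sub_right,
      real_inner_smul_left, real_inner_smul_right]
    rw [real_inner_comm (S.α k) y]
    ring
  obtain ⟨y, hy, hxy⟩ := (f.convexOn (convex_univ (𝕜 := ℝ))).exists_ge_of_mem_convexHull
    (Set.subset_univ S.orbit) hx
  have hyP : y ∈ S.P := subset_convexHull ℝ _ hy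
  rw [hfv, hfv] at hxy
  have hrx : reflMap (S.α k) x = x := by simp [reflMap, hxk]
  rw [hrx] at hxy
  have h1 := hp y hyP
  have h2 := hp _ (S.reflMap_mem_P k hyP)
  have h3 : ⟪p, y⟫ = ⟪p, reflMap (S.α k) y⟫ := by linarith
  rw [reflMap, inner_sub_right, real_inner_smul_right] at h3
  have h4 : 2 * ⟪y, S.α k⟫ / ⟪S.α k, S.α k⟫ ≠ 0 :=
    div_ne_zero (mul_ne_zero two_ne_zero (hnd.inner_ne_zero hy (S.hα_mem k))) hα
  have h5 : 2 * ⟪y, S.α k⟫ / ⟪S.α k, S.α k⟫ * ⟪p, S.α k⟫ = 0 := by linarith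
  exact (mul_eq_zero.1 h5).resolve_left h4

end PermSetup

/-! ### Counting active constraints -/

lemma linearIndepOn_id_of_span_eq_top [FiniteDimensional ℝ V] {A : Set V}
    (hspan : Submodule.span ℝ A = ⊤) (hcard : A.ncard = Module.finrank ℝ V)
    (hfin : A.Finite) : LinearIndepOn ℝ id A := by
  have := hfin.fintype
  refine linearIndependent_of_top_le_span_of_card_eq_finrank ?_ ?_
  · simp [hspan]
  · rw [← hcard, Set.ncard_eq_toFinset_card', Set.toFinset_card]

lemma ncard_eq_finrank_of_span_eq_top [FiniteDimensional ℝ V] {A : Set V}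
    (hspan : Submodule.span ℝ A = ⊤) (hind : LinearIndepOn ℝ id A) :
    A.ncard = Module.finrank ℝ V := by
  have hfin : A.Finite := LinearIndependent.setFinite hind
  have := hfin.fintype
  rw [Set.ncard_eq_toFinset_card', ← finrank_span_set_eq_card hind, hspan, finrank_top]

/-- For every point of a compact set `Q` there is an extreme point of `Q` at which all
the constraints active at the given point are active. -/
lemma exists_extremePoint_active [FiniteDimensional ℝ V] {c x : V} {Q A : Set V}
    (hQ : IsCompact Q) (hAQ : A ⊆ polarAt c Q) (hx : x ∈ Q) :
    ∃ v ∈ Set.extremePoints ℝ Q,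
      {g ∈ A | ⟪g, x - c⟫ = 1} ⊆ {g ∈ A | ⟪g, v - c⟫ = 1} := by
  set B := {g ∈ A | ⟪g, x - c⟫ = 1}
  set F := {y ∈ Q | ∀ g ∈ B, ⟪g, y - c⟫ = 1} with hF
  have hext : IsExtreme ℝ Q F := by
    refine ⟨fun y hy => hy.1, fun a ha b hb y hy hab => ?_⟩
    refine ⟨ha, fun g hg => ?_⟩
    obtain ⟨s, t, hs, ht, hst, rfl⟩ := hab
    have h1 := hy.2 g hg
    have h2 := hAQ hg.1 a ha
    have h3 := hAQ hg.1 b hb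
    have h4 : s • a + t • b - c = s • (a - c) + t • (b - c) := by
      rw [smul_sub, smul_sub, sub_add_sub_comm, ← add_smul, hst, one_smul]
    rw [h4, inner_add_right, real_inner_smul_right, real_inner_smul_right] at h1
    nlinarith
  have hcpt : IsCompact F := by
    have : F = Q ∩ ⋂ g ∈ B, {y | ⟪g, y - c⟫ = 1} := by
      ext y; simp [hF]
    rw [this]
    exact hQ.inter_right
      (isClosed_biInter fun g _ => isClosed_eq (by fun_prop) continuous_const)
  obtain ⟨v, hv⟩ := hcpt.extremePoints_nonempty ⟨x, hx, fun g hg => hg.2⟩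
  exact ⟨v, hext.extremePoints_subset_extremePoints hv, fun g hg => ⟨hg.1, hv.1.2 g hg⟩⟩

namespace PermSetup

variable {n : ℕ}

lemma isOpen_chamber (α : Fin n → V) : IsOpen {y : V | ∀ k, 0 < ⟪y, α k⟫} := by
  simp only [Set.ofPred_forall]
  exact isOpen_iInter_of_finite fun k => isOpen_lt continuous_const (by fun_prop)

lemma Nondegenerate.exists_mem_interior {S : PermSetup V n}
    (hnd : S.Nondegenerate) (hfull : (interior S.P).Nonempty) :
    ∃ c ∈ interior S.P, ∀ k, 0 < ⟪c, S.α k⟫ := by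
  obtain ⟨l, hl⟩ := S.hΛ_ne
  have hmem : l ∈ closure (interior S.P) := by
    rw [S.convex_P.closure_interior_eq_closure_of_nonempty_interior hfull]
    exact subset_closure (subset_convexHull ℝ _ (S.Λ_subset_orbit hl))
  obtain ⟨c, hc1, hc2⟩ := mem_closure_iff.1 hmem _ (isOpen_chamber S.α) (hnd l hl)
  exact ⟨c, hc2, hc1⟩

/-- The functional defining the wall of `α_k`, normalized at the base point `c`. -/
def wall (S : PermSetup V n) (c : V) (k : Fin n) : V := (-⟪c, S.α k⟫⁻¹) • S.α k

lemma inner_wall (S : PermSetup V n) {c : V} {k : Fin n} (hc : 0 < ⟪c, S.α k⟫) (y : V) :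
    ⟪S.wall c k, y - c⟫ = 1 - ⟪y, S.α k⟫ / ⟪c, S.α k⟫ := by
  rw [wall, real_inner_smul_left, inner_sub_right,
    real_inner_comm y (S.α k), real_inner_comm c (S.α k)]
  field_simp
  ring

lemma linearIndependent_wall (S : PermSetup V n) {c : V} (hc : ∀ k, 0 < ⟪c, S.α k⟫) :
    LinearIndependent ℝ (S.wall c) :=
  S.hα_indep.units_smul fun k => Units.mk0 (-⟪c, S.α k⟫⁻¹) (neg_ne_zero.2 (inv_ne_zero (hc k).ne'))

lemma halfspaces_union_wall (S : PermSetup V n) {c : V} (hc : ∀ k, 0 < ⟪c, S.α k⟫)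
    (K : Set (Fin n)) (A : Set V) :
    halfspaces c (A ∪ S.wall c '' K) = halfspaces c A ∩ cham S.α K := by
  have key : ∀ k y, ⟪S.wall c k, y - c⟫ ≤ 1 ↔ 0 ≤ ⟪y, S.α k⟫ := by
    intro k y
    rw [S.inner_wall (hc k), sub_le_self_iff, le_div_iff₀ (hc k), zero_mul]
  ext y
  constructor
  · intro h
    exact ⟨fun g hg => h g (Or.inl hg), fun k hk => (key k y).1 (h _ (Or.inr ⟨k, hk, rfl⟩))⟩
  · rintro ⟨h1, h2⟩ g (hg | ⟨k, hk, rfl⟩)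
    · exact h1 g hg
    · exact (key k y).2 (h2 k hk)

lemma isClosed_cham (α : Fin n → V) (K : Set (Fin n)) : IsClosed (cham α K) := by
  have : cham α K = ⋂ k ∈ K, {x : V | 0 ≤ ⟪x, α k⟫} := by ext; simp [cham]
  rw [this]
  exact isClosed_biInter fun k _ => isClosed_le continuous_const (by fun_prop)

lemma convex_cham (α : Fin n → V) (K : Set (Fin n)) : Convex ℝ (cham α K) := by
  intro a ha b hb s t hs ht _ k hk
  rw [inner_add_left, real_inner_smul_left, real_inner_smul_left]
  exact add_nonneg (mul_nonneg hs (ha k hk)) (mul_nonneg ht (hb k hk))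

/-- If `P` is simple, the constraints of `P ∩ C_K` active at a point are independent. -/
lemma Nondegenerate.linearIndepOn_active [FiniteDimensional ℝ V] {S : PermSetup V n}
    (hnd : S.Nondegenerate) {c x : V} (hcP : c ∈ interior S.P) (hc : ∀ k, 0 < ⟪c, S.α k⟫)
    (hsimple : IsSimple S.P) (hx : x ∈ S.P) (K : Set (Fin n)) :
    LinearIndepOn ℝ id {g ∈ Set.extremePoints ℝ (polarAt c S.P) ∪ S.wall c '' K |
      ⟪g, x - c⟫ = 1} := by
  have hfin := finite_extremePoints_polarAt_convexHull c S.finite_orbit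
  rw [← P_eq] at hfin
  have hcl := S.isCompact_P.isClosed
  have hP := halfspaces_extremePoints_polarAt hcP hcl S.convex_P
  obtain ⟨v, hv, hsub⟩ := exists_extremePoint_active (A := Set.extremePoints ℝ (polarAt c S.P))
    S.isCompact_P
    (fun g hg => hg.1) hx
  have hAv := hsimple v hv
  rw [ncard_facets_eq hcP hcl S.convex_P hfin hv.1] at hAv
  have hspan := span_active_eq_top hfin (hP.symm ▸ hv)
  have hA := (linearIndepOn_id_of_span_eq_top hspan hAv
    (hfin.subset (Set.sep_subset _ _))).mono hsub
  have hwall : LinearIndepOn ℝ id {g ∈ S.wall c '' K | ⟪g, x - c⟫ = 1} :=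
    (S.linearIndependent_wall hc).linearIndepOn_id.mono
      fun g hg => Set.image_subset_range _ _ hg.1
  refine (hA.union hwall ?_).mono ?_
  · rw [Set.image_id, Set.image_id]
    refine Submodule.IsOrtho.disjoint (Submodule.isOrtho_span.2 ?_)
    rintro g ⟨hg, hgx⟩ _ ⟨⟨k, _, rfl⟩, hk⟩
    have hxk : ⟪x, S.α k⟫ = 0 := by
      rw [S.inner_wall (hc k), sub_eq_self, div_eq_zero_iff] at hk
      exact hk.resolve_right (hc k).ne'
    have hperp := hnd.inner_eq_zero_of_isMax hx hxk (p := g) fun y hy => by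
      have := hg.1 y hy
      rw [inner_sub_right] at this hgx
      linarith
    rw [wall, real_inner_smul_right, hperp, mul_zero]
  · rintro g ⟨hg | hg, hgx⟩
    · exact Or.inl ⟨hg, hgx⟩
    · exact Or.inr ⟨hg, hgx⟩

end PermSetup

/-- If `Q ⊆ P` agree near `x`, their polar duals have the same vertices active at `x`. -/
lemma active_extremePoints_polarAt_eq {c x : V} {P Q : Set V} (hPQ : Q ⊆ P)
    (hP : Convex ℝ P) (hx : x ∈ P) (hloc : ∀ᶠ y in nhds x, y ∈ P → y ∈ Q) :
    {l ∈ Set.extremePoints ℝ (polarAt c Q) | ⟪l, x - c⟫ = 1} =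
      {l ∈ Set.extremePoints ℝ (polarAt c P) | ⟪l, x - c⟫ = 1} := by
  have hxQ : x ∈ Q := hloc.self_of_nhds hx
  have hsub : polarAt c P ⊆ polarAt c Q := fun l hl y hy => hl y (hPQ hy)
  have hback : ∀ l ∈ polarAt c Q, ⟪l, x - c⟫ = 1 → l ∈ polarAt c P := by
    intro l hl hlx y hy
    have hcont : Filter.Tendsto (fun t : ℝ => x + t • (y - x)) (nhds 0) (nhds x) := by
      have : Continuous fun t : ℝ => x + t • (y - x) := by fun_prop
      simpa using this.tendsto 0
    obtain ⟨t, ⟨ht, ht1⟩, ht0⟩ := ((((hcont.eventually hloc).and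
      (eventually_lt_nhds zero_lt_one)).filter_mono nhdsWithin_le_nhds).and
      (self_mem_nhdsWithin (s := Set.Ioi (0 : ℝ)))).exists
    have h1 := hl _ (ht (hP.add_smul_sub_mem hx hy ⟨le_of_lt ht0, ht1.le⟩))
    rw [add_sub_right_comm, inner_add_right, hlx, real_inner_smul_right] at h1
    have h2 : ⟪l, y - x⟫ ≤ 0 := by
      by_contra! h
      have := mul_pos ht0 h
      linarith
    rw [← sub_add_sub_cancel y x c, inner_add_right, hlx]
    linarith
  ext l
  refine and_congr_left fun hlx => ⟨fun hl => ?_, fun hl => ?_⟩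
  · exact inter_extremePoints_subset_extremePoints_of_subset hsub ⟨hback l hl.1 hlx, hl⟩
  · refine mem_extremePoints.2 ⟨hsub hl.1, fun a ha b hb hab => ?_⟩
    have hboth : ⟪a, x - c⟫ = 1 ∧ ⟪b, x - c⟫ = 1 := by
      obtain ⟨s, t, hs, ht, hst, rfl⟩ := hab
      have h1 := ha x hxQ
      have h2 := hb x hxQ
      rw [inner_add_left, real_inner_smul_left, real_inner_smul_left] at hlx
      constructor <;> nlinarith
    exact (mem_extremePoints.1 hl).2 a (hback a ha hboth.1) b (hback b hb hboth.2) hab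

/-- Proposition 2.6(1): for nondegenerate `P`, the polytope `P` is simple if and only
if the full-dimensional polytope `P ∩ C_K` is simple. -/
theorem statement_10 {V : Type*} [NormedAddCommGroup V] [InnerProductSpace ℝ V]
    [FiniteDimensional ℝ V] {n : ℕ} (S : PermSetup V n)
    (hfull : (interior S.P).Nonempty) (hnd : S.Nondegenerate) (K : Set (Fin n)) :
    (interior (S.P ∩ cham S.α K)).Nonempty ∧
    (IsSimple S.P ↔ IsSimple (S.P ∩ cham S.α K)) := by
  obtain ⟨c, hcP, hc⟩ := hnd.exists_mem_interior hfull
  have hcham : ∀ y : V, (∀ k, 0 < ⟪y, S.α k⟫) → cham S.α K ∈ nhds y := fun y hy =>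
    Filter.mem_of_superset ((PermSetup.isOpen_chamber S.α).mem_nhds hy) fun z hz k _ => (hz k).le
  have hcQ : c ∈ interior (S.P ∩ cham S.α K) := by
    rw [interior_inter]
    exact ⟨hcP, mem_interior_iff_mem_nhds.2 (hcham c hc)⟩
  refine ⟨⟨c, hcQ⟩, ?_⟩
  have hPcl := S.isCompact_P.isClosed
  have hPfin := finite_extremePoints_polarAt_convexHull c S.finite_orbit
  rw [← PermSetup.P_eq] at hPfin
  have hP := halfspaces_extremePoints_polarAt hcP hPcl S.convex_P
  have hQcl := hPcl.inter (PermSetup.isClosed_cham S.α K)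
  have hQcv := S.convex_P.inter (PermSetup.convex_cham S.α K)
  have hG : halfspaces c (Set.extremePoints ℝ (polarAt c S.P) ∪ S.wall c '' K) =
      S.P ∩ cham S.α K := by
    rw [S.halfspaces_union_wall hc, hP]
  have hQsub := extremePoints_polarAt_halfspaces_subset c
    (hPfin.union ((Set.toFinite K).image (S.wall c)))
  rw [hG] at hQsub
  have hQfin := ((hPfin.union ((Set.toFinite K).image (S.wall c))).insert 0).subset hQsub
  have hQ := halfspaces_extremePoints_polarAt hcQ hQcl hQcv
  constructor
  · intro hsimple x hx
    rw [ncard_facets_eq hcQ hQcl hQcv hQfin hx.1]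
    refine ncard_eq_finrank_of_span_eq_top (span_active_eq_top hQfin (hQ.symm ▸ hx)) ?_
    refine (hnd.linearIndepOn_active hcP hc hsimple hx.1.1 K).mono ?_
    rintro l ⟨hl, hlx⟩
    rcases hQsub hl with rfl | h
    · simp at hlx
    · exact ⟨h, hlx⟩
  · intro hsimple v hv
    have hvo : v ∈ S.orbit := extremePoints_convexHull_subset hv
    simp only [PermSetup.orbit, Set.mem_iUnion] at hvo
    obtain ⟨w, hw, l, hl, rfl⟩ := hvo
    obtain ⟨e, rfl, heo, _⟩ := S.exists_isometry_of_mem_WK hw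
    have heP := S.image_P e heo
    rw [ncard_facets_map e heP]
    have hlext : l ∈ Set.extremePoints ℝ S.P := by
      have h := image_extremePoints (𝕜 := ℝ) e.toLinearEquiv S.P
      have h' : e '' Set.extremePoints ℝ S.P = Set.extremePoints ℝ S.P :=
        h.trans (congrArg (Set.extremePoints ℝ) heP)
      rw [← h'] at hv
      exact (e.injective.mem_set_image).1 hv
    have hlP := hlext.1
    have hlQ : l ∈ S.P ∩ cham S.α K := ⟨hlP, fun k _ => (hnd l hl k).le⟩
    have hcard := hsimple l
      (inter_extremePoints_subset_extremePoints_of_subset Set.inter_subset_left ⟨hlQ, hlext⟩)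
    rw [ncard_facets_eq hcQ hQcl hQcv hQfin hlQ, active_extremePoints_polarAt_eq
      Set.inter_subset_left S.convex_P hlP ?_] at hcard
    · rwa [ncard_facets_eq hcP hPcl S.convex_P hPfin hlP]
    · filter_upwards [hcham l (hnd l hl)] with y hy hyP using ⟨hyP, hy⟩
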